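/- Let n be a positive integer and let (S_{n-1}, C_n, ▷, ◁) be the canonical matched pair associated to the factorization S_n = S_{n-1} C_n. Then the number of isomorphism classes of groups of order n equals |D(C_n, S_{n-1} | ▷, ◁)|, the cardinality of the set of equivalence classes of deformation maps r : C_n → S_{n-1} of this matched pair. -/

import Mathlib

section

variable {n : ℕ} (A C : Subgroup (Equiv.Perm (Fin n)))
variable (tr : C → A → A) (tl : C → A → C)

/-- The subtype of deformation maps `r : C_n → S_{n-1}` of the matched pair
`(S_{n-1}, C_n, ▷, ◁)`. -/
def DefMap : Type _ :=
  {r : C → A // r 1 = 1 ∧ ∀ h g : C, r (tl h (r g) * g) = r h * tr h (r g)}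

/-- The equivalence relation `~` on deformation maps: `r ~ R` iff there is a bijection
`σ : C → C` with `σ(1) = 1` and `σ((h ◁ r(g)) g) = (σ(h) ◁ R(σ(g))) σ(g)`; the quotient
`Quot (dmRel ...)` is the set `D(C_n, S_{n-1} | ▷, ◁)` of equivalence classes of
deformation maps. -/
def dmRel (r R : DefMap A C tr tl) : Prop :=
  ∃ σ : C → C, Function.Bijective σ ∧ σ 1 = 1 ∧
    ∀ h g : C, σ (tl h (r.val g) * g) = tl (σ h) (R.val (σ g)) * σ g

/-- The multiplication of a group structure `g` on `X`. -/
def mulOf {X : Type*} (g : Group X) : Mul X := letI := g; inferInstance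

/-- Two group structures on `Fin n` are isomorphic; the quotient `Quot (grpRel n)` is the
set of isomorphism classes of groups of order `n`. -/
def grpRel (n : ℕ) (g₁ g₂ : Group (Fin n)) : Prop :=
  Nonempty (@MulEquiv (Fin n) (Fin n) (mulOf g₁) (mulOf g₂))

lemma exists_group_of_op {X : Type*} [Finite X] (op : X → X → X) (e : X)
    (hassoc : ∀ a b c, op (op a b) c = op a (op b c)) (hone : ∀ a, op e a = a)
    (hinj : ∀ b, Function.Injective fun a => op a b) :
    ∃ g : Group X, ∀ a b, (mulOf g).mul a b = op a b := by
  choose inv hinv using fun b => (Finite.injective_iff_surjective.1 (hinj b)) e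
  exact ⟨@Group.ofLeftAxioms X ⟨op⟩ ⟨inv⟩ ⟨e⟩ hassoc hone hinv, fun _ _ => rfl⟩

lemma nonempty_mulEquiv_iff {X Y : Type*} [Mul X] [Mul Y] :
    Nonempty (X ≃* Y) ↔
      ∃ f : X → Y, Function.Bijective f ∧ ∀ a b, f (a * b) = f a * f b :=
  ⟨fun ⟨f⟩ => ⟨f, f.bijective, f.map_mul⟩,
    fun ⟨f, hf, hmul⟩ => ⟨⟨Equiv.ofBijective f hf, hmul⟩⟩⟩

lemma grpRel_iff {n : ℕ} (g₁ g₂ : Group (Fin n)) :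
    grpRel n g₁ g₂ ↔ ∃ f : Fin n → Fin n, Function.Bijective f ∧
      ∀ a b, f ((mulOf g₁).mul a b) = (mulOf g₂).mul (f a) (f b) :=
  @nonempty_mulEquiv_iff _ _ (mulOf g₁) (mulOf g₂)

lemma grpRel_equivalence (n : ℕ) : Equivalence (grpRel n) where
  refl g := ⟨@MulEquiv.refl _ (mulOf g)⟩
  symm := fun {g₁ g₂} ⟨f⟩ => ⟨@MulEquiv.symm _ _ (mulOf g₁) (mulOf g₂) f⟩
  trans := fun {g₁ g₂ g₃} ⟨f⟩ ⟨f'⟩ =>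
    ⟨@MulEquiv.trans _ _ _ (mulOf g₁) (mulOf g₂) (mulOf g₃) f f'⟩

lemma prod_swap_apply {n : ℕ} (s : ℕ → Equiv.Perm (Fin n))
    (hs : ∀ i (h1 : 1 ≤ i) (h2 : i ≤ n - 1),
      s i = Equiv.swap (⟨i - 1, by omega⟩ : Fin n) (⟨i, by omega⟩ : Fin n))
    (m : ℕ) (hm : m ≤ n - 1) (j : Fin n) :
    ((((List.range m).map fun j => s (j + 1)).prod j : Fin n) : ℕ) =
      if (j : ℕ) < m then (j : ℕ) + 1 else if (j : ℕ) = m then 0 else j := by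
  induction m generalizing j with
  | zero => by_cases h : (j : ℕ) = 0 <;> simp [h]
  | succ k ih =>
    rw [List.range_succ, List.map_append, List.prod_append, Equiv.Perm.mul_apply]
    rw [ih (by omega)]
    simp only [List.map_cons, List.map_nil, List.prod_singleton, hs (k + 1) (by omega) hm,
      Equiv.swap_apply_def, Fin.ext_iff]
    split_ifs <;> simp_all <;> omega

/-- The group generated by the `n`-cycle acts regularly. -/
lemma bijective_zpowers_apply {n : ℕ} (x : Equiv.Perm (Fin n))
    (hx : ∀ j : Fin n, (j : ℕ) + 1 < n → ((x j : Fin n) : ℕ) = j + 1) (p : Fin n) :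
    Function.Bijective fun c : Subgroup.zpowers x => (c : Equiv.Perm (Fin n))⁻¹ p := by
  have hn : 0 < n := p.pos
  have hpow : ∀ k (hk : k < n), (x ^ k) ⟨0, hn⟩ = ⟨k, hk⟩ := by
    intro k hk
    induction k with
    | zero => rfl
    | succ k ih =>
      rw [pow_succ', Equiv.Perm.mul_apply, ih (by omega)]
      exact Fin.ext (hx _ hk)
  have htrans : ∀ q : Fin n, ∃ c : Subgroup.zpowers x, (c : Equiv.Perm (Fin n))⁻¹ p = q := by
    intro q
    refine ⟨⟨x ^ (p : ℕ) * (x ^ (q : ℕ))⁻¹, mul_mem (Subgroup.npow_mem_zpowers _ _)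
      (inv_mem (Subgroup.npow_mem_zpowers _ _))⟩, ?_⟩
    rw [mul_inv_rev, inv_inv, Equiv.Perm.mul_apply, Equiv.Perm.inv_eq_iff_eq.2 (hpow p p.2).symm,
      hpow q q.2]
  refine ⟨fun c d hcd => ?_, htrans⟩
  have hcd : (c : Equiv.Perm (Fin n))⁻¹ p = (d : Equiv.Perm (Fin n))⁻¹ p := hcd
  rw [← inv_inj]
  refine Subtype.ext (Equiv.ext fun q => ?_)
  obtain ⟨b, rfl⟩ := htrans q
  have hcomm : ∀ u : Subgroup.zpowers x, (u : Equiv.Perm (Fin n))⁻¹ * (b : Equiv.Perm (Fin n))⁻¹ =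
      (b : Equiv.Perm (Fin n))⁻¹ * (u : Equiv.Perm (Fin n))⁻¹ := by
    rintro ⟨u, k, rfl⟩
    obtain ⟨b, l, rfl⟩ := b
    exact ((Commute.zpow_zpow_self x k l).inv_inv).eq
  simp only [InvMemClass.coe_inv, ← Equiv.Perm.mul_apply, hcomm]
  simp only [Equiv.Perm.mul_apply, hcd]

section MatchedPair

variable {A C tr tl} {p : Fin n}
  (hA : ∀ a : Equiv.Perm (Fin n), a ∈ A ↔ a p = p)
  (he : Function.Bijective fun c : C => (c : Equiv.Perm (Fin n))⁻¹ p)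
  (hcanon : ∀ (h : C) (a : A),
    (h : Equiv.Perm (Fin n)) * (a : Equiv.Perm (Fin n)) =
      (tr h a : Equiv.Perm (Fin n)) * (tl h a : Equiv.Perm (Fin n)))

include hA he in
lemma factorization_right_unique {a b : A} {c d : C}
    (h : (a : Equiv.Perm (Fin n)) * c = b * d) : c = d := by
  apply he.1
  have ha := (hA _).1 (inv_mem a.2)
  have hb := (hA _).1 (inv_mem b.2)
  have := congrArg (fun u : Equiv.Perm (Fin n) => u⁻¹ p) h
  simpa only [mul_inv_rev, Equiv.Perm.mul_apply, ha, hb] using this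

include hcanon in
/-- The elements `r(h)h` multiply according to the operation deformed by `r`. -/
lemma DefMap.mul_mul (r : DefMap A C tr tl) (h g : C) :
    ((r.1 h : Equiv.Perm (Fin n)) * h) * (r.1 g * g) =
      r.1 (tl h (r.1 g) * g) * (tl h (r.1 g) * g : C) := by
  rw [r.2.2 h g, Subgroup.coe_mul, Subgroup.coe_mul]
  simp only [mul_assoc]
  rw [← mul_assoc (h : Equiv.Perm (Fin n)), hcanon]
  simp only [mul_assoc]

include hA he hcanon in
lemma DefMap.exists_group (r : DefMap A C tr tl) :
    ∃ g : Group (Fin n), ∀ a b : C, (mulOf g).mul ((a : Equiv.Perm (Fin n))⁻¹ p)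
      ((b : Equiv.Perm (Fin n))⁻¹ p) =
        ((tl a (r.1 b) * b : C) : Equiv.Perm (Fin n))⁻¹ p := by
  let e : C ≃ Fin n := Equiv.ofBijective _ he
  have hinj : Function.Injective fun h : C => (r.1 h : Equiv.Perm (Fin n)) * h :=
    fun _ _ h => factorization_right_unique hA he h
  have hmul := DefMap.mul_mul hcanon r
  obtain ⟨g, hg⟩ := exists_group_of_op
    (fun a b => e (tl (e.symm a) (r.1 (e.symm b)) * e.symm b)) (e 1)
    (fun a b c => by
      refine congrArg e (hinj ?_)
      simp only [Equiv.symm_apply_apply, ← hmul, mul_assoc])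
    (fun a => by
      rw [← e.eq_symm_apply]
      apply hinj
      simp only [Equiv.symm_apply_apply, ← hmul, r.2.1, OneMemClass.coe_one, one_mul])
    (fun b a a' h => by
      have h := congrArg (fun k : C => (r.1 k : Equiv.Perm (Fin n)) * k) (e.injective h)
      simp only [← hmul] at h
      exact e.symm.injective (hinj (mul_right_cancel h)))
  refine ⟨g, fun a b => ?_⟩
  refine (hg (e a) (e b)).trans ?_
  simp only [Equiv.symm_apply_apply]
  rfl

include hA he hcanon in
/-- Every group of order `n` arises from a deformation map, by Cayley's theorem. -/
lemma exists_defMap_of_group {G : Type*} [Group G] (ε : G ≃ Fin n) :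
    ∃ (r : DefMap A C tr tl) (φ : C → G), Function.Bijective φ ∧
      ∀ h g : C, φ (tl h (r.1 g) * g) = φ h * φ g := by
  let L : G → Equiv.Perm (Fin n) := fun g => ε.permCongr (Equiv.mulLeft g)
  have hL : ∀ g q, L g q = ε (g * ε.symm q) := fun _ _ => rfl
  have hLmul : ∀ g h, L (g * h) = L g * L h := fun g h => Equiv.ext fun q => by
    simp only [Equiv.Perm.mul_apply, hL, Equiv.symm_apply_apply, mul_assoc]
  let φ : C → G := fun c => ε.symm p * (ε.symm ((c : Equiv.Perm (Fin n))⁻¹ p))⁻¹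
  have hφ : Function.Bijective φ := (Equiv.mulLeft (ε.symm p)).bijective.comp
    ((Equiv.inv G).bijective.comp (ε.symm.bijective.comp he))
  have hLφ : ∀ (u : G) (c : C), L u ((c : Equiv.Perm (Fin n))⁻¹ p) = p → u = φ c := by
    intro u c h
    rw [hL, ← ε.eq_symm_apply] at h
    exact eq_mul_inv_of_mul_eq h
  have hφL : ∀ c : C, L (φ c) * (c : Equiv.Perm (Fin n))⁻¹ ∈ A := by
    intro c
    rw [hA, Equiv.Perm.mul_apply, hL, inv_mul_cancel_right, ε.apply_symm_apply]
  let r : C → A := fun c => ⟨_, hφL c⟩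
  have hr : ∀ c : C, (r c : Equiv.Perm (Fin n)) * c = L (φ c) :=
    fun c => inv_mul_cancel_right _ _
  have hkey : ∀ h g : C, L (φ h * φ g) =
      (r h * tr h (r g) : A) * (tl h (r g) * g : C) := by
    intro h g
    rw [hLmul, ← hr, ← hr, Subgroup.coe_mul, Subgroup.coe_mul]
    simp only [mul_assoc]
    rw [← mul_assoc (h : Equiv.Perm (Fin n)), hcanon]
    simp only [mul_assoc]
  have hφmul : ∀ h g : C, φ (tl h (r g) * g) = φ h * φ g := by
    intro h g
    refine (hLφ _ _ ?_).symm
    rw [hkey, Equiv.Perm.mul_apply, ← Equiv.Perm.mul_apply _ _⁻¹, mul_inv_cancel]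
    exact (hA _).1 (SetLike.coe_mem _)
  refine ⟨⟨r, ?_, fun h g => ?_⟩, φ, hφ, hφmul⟩
  · refine Subtype.ext (Equiv.ext fun q => ?_)
    have h1 : φ 1 = 1 := (hLφ 1 1 (by simp [hL])).symm
    simp [r, h1, hL]
  · refine Subtype.ext (mul_right_cancel (b := ((tl h (r g) * g : C) : Equiv.Perm (Fin n))) ?_)
    rw [hr, hφmul, hkey]

include hA he hcanon in
lemma exists_defMap (G : Group (Fin n)) :
    ∃ (r : DefMap A C tr tl) (φ : C → Fin n), Function.Bijective φ ∧
      ∀ h g : C, φ (tl h (r.1 g) * g) = (mulOf G).mul (φ h) (φ g) :=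
  @exists_defMap_of_group _ A C tr tl p hA he hcanon _ G (Equiv.refl _)

include hA he hcanon in
/-- Equivalence of deformation maps is isomorphism of the corresponding groups. -/
lemma dmRel_iff (r R : DefMap A C tr tl) (g₁ g₂ : Group (Fin n))
    (φ ψ : C → Fin n) (hφ : Function.Bijective φ) (hψ : Function.Bijective ψ)
    (hφmul : ∀ a b : C, φ (tl a (r.1 b) * b) = (mulOf g₁).mul (φ a) (φ b))
    (hψmul : ∀ a b : C, ψ (tl a (R.1 b) * b) = (mulOf g₂).mul (ψ a) (ψ b)) :
    dmRel A C tr tl r R ↔ grpRel n g₁ g₂ := by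
  rw [grpRel_iff]
  let e₁ := Equiv.ofBijective φ hφ
  let e₂ := Equiv.ofBijective ψ hψ
  have h₁ : ∀ c, e₁ c = φ c := fun _ => rfl
  have h₂ : ∀ c, e₂ c = ψ c := fun _ => rfl
  simp only [← h₁, ← h₂] at hφmul hψmul
  constructor
  · rintro ⟨σ, hσ, -, hmul⟩
    refine ⟨e₂ ∘ σ ∘ e₁.symm, e₂.bijective.comp (hσ.comp e₁.symm.bijective), fun a b => ?_⟩
    obtain ⟨a, rfl⟩ := e₁.surjective a
    obtain ⟨b, rfl⟩ := e₁.surjective b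
    simp only [Function.comp_apply, ← hφmul, ← hψmul, Equiv.symm_apply_apply, hmul]
  · rintro ⟨f, hf, hmul⟩
    have hσ : ∀ h g : C, (e₂.symm ∘ f ∘ e₁) (tl h (r.1 g) * g) =
        tl ((e₂.symm ∘ f ∘ e₁) h) (R.1 ((e₂.symm ∘ f ∘ e₁) g)) * (e₂.symm ∘ f ∘ e₁) g := by
      intro h g
      simp only [Function.comp_apply, Equiv.symm_apply_eq, hφmul, hψmul, hmul,
        Equiv.apply_symm_apply]
    refine ⟨_, e₂.symm.bijective.comp (hf.comp e₁.bijective), ?_, hσ⟩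
    -- `1` is idempotent for the deformed operation, and so is its image
    set σ := e₂.symm ∘ f ∘ e₁
    have htl : ∀ h : C, tl h 1 = h := fun h =>
      (factorization_right_unique hA he (a := 1) (b := tr h 1) (by simpa using hcanon h 1)).symm
    have h11 := hσ 1 1
    rw [r.2.1, htl, mul_one] at h11
    have hmul := DefMap.mul_mul hcanon R (σ 1) (σ 1)
    rw [← h11] at hmul
    have h1 : ((R.1 (σ 1) : A) : Equiv.Perm (Fin n)) * (σ 1 : C) = (1 : A) * (1 : C) := by
      simpa using hmul
    exact factorization_right_unique hA he h1

end MatchedPair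

/-- Let `S_n = Perm (Fin n)` (0-indexed), `s i` the adjacent transpositions,
`A = S_{n-1}` the stabilizer of the last point, `x = s 1 * ⋯ * s (n-1)`, `C = C_n = ⟨x⟩`,
and `(S_{n-1}, C_n, ▷, ◁)` the canonical matched pair of the factorization
`S_n = S_{n-1} C_n`.  Then the number of isomorphism classes of groups of order `n`
equals `|D(C_n, S_{n-1} | ▷, ◁)|`, the number of equivalence classes of deformation maps
`r : C_n → S_{n-1}`. -/
theorem stmt19 (hn : 0 < n) (s : ℕ → Equiv.Perm (Fin n))
    (hs : ∀ i (h1 : 1 ≤ i) (h2 : i ≤ n - 1),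
      s i = Equiv.swap (⟨i - 1, by omega⟩ : Fin n) (⟨i, by omega⟩ : Fin n))
    (x : Equiv.Perm (Fin n))
    (hx : x = ((List.range (n - 1)).map fun j => s (j + 1)).prod)
    (hA : A = MulAction.stabilizer (Equiv.Perm (Fin n)) (⟨n - 1, by omega⟩ : Fin n))
    (hC : C = Subgroup.zpowers x)
    (hcanon : ∀ (h : C) (a : A),
      (h : Equiv.Perm (Fin n)) * (a : Equiv.Perm (Fin n)) =
        (tr h a : Equiv.Perm (Fin n)) * (tl h a : Equiv.Perm (Fin n))) :
    Cardinal.mk (Quot (grpRel n)) = Cardinal.mk (Quot (dmRel A C tr tl)) := by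
  subst hC
  have hx' : ∀ j : Fin n, (j : ℕ) + 1 < n → ((x j : Fin n) : ℕ) = j + 1 := fun j hj => by
    rw [hx, prod_swap_apply s hs _ le_rfl, if_pos (by omega)]
  have he := bijective_zpowers_apply x hx' ⟨n - 1, by omega⟩
  have hA' : ∀ a : Equiv.Perm (Fin n), a ∈ A ↔ a ⟨n - 1, by omega⟩ = ⟨n - 1, by omega⟩ := by
    intro a
    rw [hA, MulAction.mem_stabilizer_iff, Equiv.Perm.smul_def]
  choose G hG using DefMap.exists_group hA' he hcanon
  have hrel : ∀ r R, dmRel A _ tr tl r R ↔ grpRel n (G r) (G R) := fun r R =>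
    dmRel_iff hA' he hcanon r R _ _ _ _ he he (fun a b => (hG r a b).symm)
      fun a b => (hG R a b).symm
  refine (Cardinal.mk_congr (Equiv.ofBijective
    (Quot.map G fun r R h => (hrel r R).1 h) ⟨?_, ?_⟩)).symm
  · rintro ⟨r⟩ ⟨R⟩ h
    exact Quot.sound ((hrel r R).2 ((grpRel_equivalence n).quot_mk_eq_iff _ _ |>.1 h))
  · rintro ⟨g⟩
    obtain ⟨r, φ, hφ, hmul⟩ := exists_defMap hA' he hcanon g
    exact ⟨Quot.mk _ r, Quot.sound ((dmRel_iff hA' he hcanon r r _ _ _ _ he hφ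
      (fun a b => (hG r a b).symm) hmul).1 ⟨id, Function.bijective_id, rfl, fun _ _ => rfl⟩)⟩

end
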